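/- (Theorem 1, Catoni's bound.) Let Θ and Z be measurable spaces, let L : Θ × Z → [0, 1] be measurable, let D be a probability measure on Z, and define R(θ) = E_{z∼D}[L(θ, z)] and, for S = (z_1, …, z_m) ∈ Z^m, R_S(θ) = (1/m) Σ_{i=1}^m L(θ, z_i). Let P be a probability measure on Θ, α > 1, and δ ∈ (0, 1]. Then with probability at least 1 − δ over S drawn from the m-fold product measure D^⊗m, for all probability measures Q on Θ: E_{θ∼Q}[R(θ)] ≤ inf_{λ > 1} Φ_{λ/m}^{−1}[ E_{θ∼Q}[R_S(θ)] + (α/λ)( KL(Q‖P) − log δ + 2 log( log(α²λ) / log α ) ) ], where Φ_γ^{−1}(t) = (1 − exp(−γt)) / (1 − exp(−γ)). -/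

import Mathlib

open MeasureTheory ProbabilityTheory Real
open scoped Classical

/-- The Kullback–Leibler divergence `KL(Q‖P)`, equal to `∫ log (dQ/dP) dQ` when `Q ≪ P`
(and the log-likelihood ratio is integrable), and `+∞` otherwise. -/
noncomputable def klDiv {α : Type*} [MeasurableSpace α] (Q P : Measure α) : ENNReal :=
  if Q ≪ P ∧ Integrable (llr Q P) Q then ENNReal.ofReal (∫ a, llr Q P a ∂Q) else ⊤

/-- `Φ_γ⁻¹(t) = (1 − exp(−γt)) / (1 − exp(−γ))`. -/
noncomputable def Phinv (γ t : ℝ) : ℝ := (1 - Real.exp (-γ * t)) / (1 - Real.exp (-γ))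

lemma exp_neg_mul_le_one_sub {γ x : ℝ} (hx : x ∈ Set.Icc (0 : ℝ) 1) :
    exp (-γ * x) ≤ 1 - (1 - exp (-γ)) * x := by
  have h := convexOn_exp.2 (Set.mem_univ (-γ)) (Set.mem_univ 0) hx.1
    (sub_nonneg.2 hx.2) (by ring)
  simp only [smul_eq_mul, mul_zero, add_zero, exp_zero, mul_one] at h
  rw [mul_comm] at h
  linarith

lemma one_sub_exp_neg_pos {γ : ℝ} (hγ : 0 < γ) : 0 < 1 - exp (-γ) :=
  sub_pos.2 (exp_lt_one_iff.2 (neg_lt_zero.2 hγ))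

lemma Phinv_monotone_right {γ : ℝ} (hγ : 0 < γ) : Monotone (Phinv γ) := by
  intro s t hst
  unfold Phinv
  have hc := one_sub_exp_neg_pos hγ
  have h : exp (-γ * t) ≤ exp (-γ * s) :=
    exp_le_exp.2 (mul_le_mul_of_nonpos_left hst (neg_nonpos.2 hγ.le))
  exact div_le_div_of_nonneg_right (sub_le_sub_left h 1) hc.le

lemma one_le_Phinv {γ t : ℝ} (hγ : 0 < γ) (ht : 1 ≤ t) : 1 ≤ Phinv γ t := by
  have h : Phinv γ 1 = 1 := by
    simp only [Phinv, mul_one]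
    exact div_self (one_sub_exp_neg_pos hγ).ne'
  exact h ▸ Phinv_monotone_right hγ ht

lemma Phinv_mono_left {γ γ' t : ℝ} (hγ : 0 < γ) (hγ' : γ ≤ γ') (ht : t ∈ Set.Icc (0 : ℝ) 1) :
    Phinv γ t ≤ Phinv γ' t := by
  have ha := one_sub_exp_neg_pos hγ
  have hb := one_sub_exp_neg_pos (hγ.trans_le hγ')
  have hab : 1 - exp (-γ) ≤ 1 - exp (-γ') := by gcongr
  set s := (1 - exp (-γ)) / (1 - exp (-γ')) with hs
  have hs0 : 0 ≤ s := by positivity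
  have hs1 : s ≤ 1 := (div_le_one hb).2 hab
  have hsb : s * (1 - exp (-γ')) = 1 - exp (-γ) := div_mul_cancel₀ _ hb.ne'
  have h := (Real.concaveOn_rpow ht.1 ht.2).2 (Set.mem_Ici.2 (exp_pos (-γ')).le)
    (Set.mem_Ici.2 (zero_le_one' ℝ)) hs0 (sub_nonneg.2 hs1) (by ring)
  have hc : s • exp (-γ') + (1 - s) • (1 : ℝ) = exp (-γ) := by
    simp only [smul_eq_mul]; linarith
  simp only [hc] at h
  simp only [smul_eq_mul, Real.one_rpow, mul_one, ← Real.exp_mul] at h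
  unfold Phinv
  rw [div_le_div_iff₀ ha hb, ← hsb]
  nlinarith

/-- One half of the Donsker–Varadhan variational formula. -/
lemma integral_le_integral_llr_add_log {Θ : Type*} [MeasurableSpace Θ] {P Q : Measure Θ}
    [IsProbabilityMeasure P] [IsProbabilityMeasure Q] (hQP : Q ≪ P)
    (hllr : Integrable (llr Q P) Q) {f : Θ → ℝ} (hfQ : Integrable f Q)
    (hfP : Integrable (fun θ => exp (f θ)) P) :
    ∫ θ, f θ ∂Q ≤ ∫ θ, llr Q P θ ∂Q + log (∫ θ, exp (f θ) ∂P) := by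
  have := isProbabilityMeasure_tilted hfP
  have h := InformationTheory.integral_llr_add_sub_measure_univ_nonneg
    (hQP.trans (absolutelyContinuous_tilted hfP))
    (integrable_llr_tilted_right hQP hfQ hllr hfP)
  rw [integral_llr_tilted_right hQP hfQ hfP hllr] at h
  simp only [probReal_univ] at h
  linarith

/-- The logarithm of the likelihood-type weight `exp (-γ ∑ L) / (1 - (1 - exp (-γ)) R) ^ m`
whose expectation over the sample is at most one. -/
noncomputable def catoniExponent {Θ 𝒵 : Type*} [MeasurableSpace 𝒵] (L : Θ → 𝒵 → ℝ)
    (D : Measure 𝒵) {m : ℕ} (γ : ℝ) (S : Fin m → 𝒵) (θ : Θ) : ℝ :=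
  ∑ i, (-γ * L θ (S i) - log (1 - (1 - exp (-γ)) * ∫ z, L θ z ∂D))

section Catoni

variable {Θ 𝒵 : Type*} [MeasurableSpace Θ] [MeasurableSpace 𝒵] {L : Θ → 𝒵 → ℝ}
  {D : Measure 𝒵} [IsProbabilityMeasure D] {m : ℕ} {P : Measure Θ} [IsProbabilityMeasure P]

lemma integral_mem_Icc_of_forall_mem {X : Type*} [MeasurableSpace X] {μ : Measure X}
    [IsProbabilityMeasure μ] {g : X → ℝ} (hg : Measurable g)
    (hg01 : ∀ x, g x ∈ Set.Icc (0 : ℝ) 1) : ∫ x, g x ∂μ ∈ Set.Icc (0 : ℝ) 1 := by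
  refine ⟨integral_nonneg fun x => (hg01 x).1, ?_⟩
  have h := integral_mono (Integrable.of_mem_Icc 0 1 hg.aemeasurable (ae_of_all μ hg01))
    (integrable_const 1) (fun x => (hg01 x).2)
  simpa using h

lemma one_sub_mul_pos {γ r : ℝ} (hr : r ∈ Set.Icc (0 : ℝ) 1) :
    0 < 1 - (1 - exp (-γ)) * r :=
  (exp_pos _).trans_le (exp_neg_mul_le_one_sub hr)

lemma measurable_catoniExponent (hL : Measurable (Function.uncurry L)) (γ : ℝ) :
    Measurable (fun p : (Fin m → 𝒵) × Θ => catoniExponent L D γ p.1 p.2) := by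
  have hR : Measurable fun θ => ∫ z, L θ z ∂D :=
    hL.stronglyMeasurable.integral_prod_right.measurable
  have hLi : ∀ i : Fin m, Measurable fun p : (Fin m → 𝒵) × Θ => L p.2 (p.1 i) := fun i =>
    hL.comp (measurable_snd.prodMk ((measurable_pi_apply i).comp measurable_fst))
  unfold catoniExponent
  refine Finset.measurable_fun_sum _ fun i _ => ((hLi i).const_mul _).sub ?_
  exact (((hR.comp measurable_snd).const_mul _).const_sub _).log

lemma catoniExponent_mem_Icc (hL : Measurable (Function.uncurry L))
    (hL01 : ∀ θ z, L θ z ∈ Set.Icc (0 : ℝ) 1) {γ : ℝ} (hγ : 0 < γ) (S : Fin m → 𝒵) (θ : Θ) :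
    catoniExponent L D γ S θ ∈ Set.Icc (-(m * γ)) (m * γ) := by
  have hR : ∫ z, L θ z ∂D ∈ Set.Icc (0 : ℝ) 1 :=
    integral_mem_Icc_of_forall_mem (hL.comp measurable_prodMk_left) (hL01 θ)
  have hc := one_sub_exp_neg_pos hγ
  have hlog0 : log (1 - (1 - exp (-γ)) * ∫ z, L θ z ∂D) ≤ 0 :=
    log_nonpos (one_sub_mul_pos hR).le (by nlinarith [hR.1])
  have hlog1 : -γ ≤ log (1 - (1 - exp (-γ)) * ∫ z, L θ z ∂D) := by
    rw [le_log_iff_exp_le (one_sub_mul_pos hR)]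
    nlinarith [hR.2]
  have hi : ∀ i : Fin m, -γ ≤ -γ * L θ (S i) - log (1 - (1 - exp (-γ)) * ∫ z, L θ z ∂D) ∧
      -γ * L θ (S i) - log (1 - (1 - exp (-γ)) * ∫ z, L θ z ∂D) ≤ γ := fun i => by
    have := hL01 θ (S i)
    constructor <;> nlinarith [this.1, this.2]
  constructor
  · have h := Finset.card_nsmul_le_sum Finset.univ _ _ fun i _ => (hi i).1
    rwa [Finset.card_univ, Fintype.card_fin, nsmul_eq_mul, mul_neg] at h
  · have h := Finset.sum_le_card_nsmul Finset.univ _ _ fun i _ => (hi i).2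
    rwa [Finset.card_univ, Fintype.card_fin, nsmul_eq_mul] at h

lemma integral_exp_catoniExponent_le_one (hL : Measurable (Function.uncurry L))
    (hL01 : ∀ θ z, L θ z ∈ Set.Icc (0 : ℝ) 1) {γ : ℝ} (θ : Θ) :
    ∫ S : Fin m → 𝒵, exp (catoniExponent L D γ S θ) ∂Measure.pi (fun _ => D) ≤ 1 := by
  have hLθ : Measurable (L θ) := hL.comp measurable_prodMk_left
  have hR : ∫ z, L θ z ∂D ∈ Set.Icc (0 : ℝ) 1 :=
    integral_mem_Icc_of_forall_mem hLθ (hL01 θ)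
  have hq := one_sub_mul_pos (γ := γ) hR
  have hLint : Integrable (L θ) D :=
    Integrable.of_mem_Icc 0 1 hLθ.aemeasurable (ae_of_all D (hL01 θ))
  have hprod : ∀ S : Fin m → 𝒵, exp (catoniExponent L D γ S θ) =
      ∏ i, exp (-γ * L θ (S i)) / (1 - (1 - exp (-γ)) * ∫ z, L θ z ∂D) := fun S => by
    simp only [catoniExponent, exp_sum, exp_sub, exp_log hq]
  simp_rw [hprod]
  rw [integral_fintype_prod_eq_pow
    (fun z => exp (-γ * L θ z) / (1 - (1 - exp (-γ)) * ∫ z, L θ z ∂D))]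
  refine pow_le_one₀ (integral_nonneg fun z => (div_pos (exp_pos _) hq).le) ?_
  rw [integral_div, div_le_one hq]
  have hmono : ∫ z, exp (-γ * L θ z) ∂D ≤ ∫ z, (1 - (1 - exp (-γ)) * L θ z) ∂D :=
    integral_mono_of_nonneg (ae_of_all D fun z => (exp_pos _).le)
      ((integrable_const 1).sub (hLint.const_mul _))
      (ae_of_all D fun z => exp_neg_mul_le_one_sub (hL01 θ z))
  rwa [integral_sub (integrable_const 1) (hLint.const_mul _), integral_const_mul,
    integral_const, probReal_univ, one_smul] at hmono

lemma integrable_exp_catoniExponent {X : Type*} [MeasurableSpace X] {μ : Measure X}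
    [IsFiniteMeasure μ] (hL : Measurable (Function.uncurry L))
    (hL01 : ∀ θ z, L θ z ∈ Set.Icc (0 : ℝ) 1) {γ : ℝ} (hγ : 0 < γ)
    {g : X → (Fin m → 𝒵) × Θ} (hg : Measurable g) :
    Integrable (fun x => exp (catoniExponent L D γ (g x).1 (g x).2)) μ :=
  Integrable.of_mem_Icc _ _
    ((measurable_catoniExponent hL γ).comp hg).exp.aemeasurable
    (ae_of_all μ fun _ => ⟨exp_le_exp.2 (catoniExponent_mem_Icc hL hL01 hγ _ _).1,
      exp_le_exp.2 (catoniExponent_mem_Icc hL hL01 hγ _ _).2⟩)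

lemma measurable_lintegral_exp_catoniExponent (hL : Measurable (Function.uncurry L)) (γ : ℝ) :
    Measurable fun S : Fin m → 𝒵 =>
      ∫⁻ θ, ENNReal.ofReal (exp (catoniExponent L D γ S θ)) ∂P :=
  (measurable_catoniExponent hL γ).exp.ennreal_ofReal.lintegral_prod_right'

lemma lintegral_lintegral_exp_catoniExponent_le_one (hL : Measurable (Function.uncurry L))
    (hL01 : ∀ θ z, L θ z ∈ Set.Icc (0 : ℝ) 1) {γ : ℝ} (hγ : 0 < γ) :
    ∫⁻ S : Fin m → 𝒵, ∫⁻ θ, ENNReal.ofReal (exp (catoniExponent L D γ S θ)) ∂P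
      ∂Measure.pi (fun _ => D) ≤ 1 := by
  rw [lintegral_lintegral_swap
    (measurable_catoniExponent hL γ).exp.ennreal_ofReal.aemeasurable]
  have hθ : ∀ θ, ∫⁻ S : Fin m → 𝒵, ENNReal.ofReal (exp (catoniExponent L D γ S θ))
      ∂Measure.pi (fun _ => D) ≤ 1 := fun θ => by
    rw [← ofReal_integral_eq_lintegral_ofReal
      (integrable_exp_catoniExponent hL hL01 hγ (g := fun S => (S, θ)) (by fun_prop))
      (ae_of_all _ fun S => (exp_pos _).le)]
    exact ENNReal.ofReal_le_one.2 (integral_exp_catoniExponent_le_one hL hL01 θ)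
  exact (lintegral_mono hθ).trans (by simp)

lemma measure_le_lintegral_exp_catoniExponent (hL : Measurable (Function.uncurry L))
    (hL01 : ∀ θ z, L θ z ∈ Set.Icc (0 : ℝ) 1) {γ ε : ℝ} (hγ : 0 < γ) (hε : 0 < ε) :
    Measure.pi (fun _ : Fin m => D) {S | ENNReal.ofReal ε⁻¹ ≤
      ∫⁻ θ, ENNReal.ofReal (exp (catoniExponent L D γ S θ)) ∂P} ≤ ENNReal.ofReal ε := by
  have h := (mul_meas_ge_le_lintegral
    (μ := Measure.pi (fun _ : Fin m => D))
    (measurable_lintegral_exp_catoniExponent (D := D) (P := P) hL γ)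
    (ENNReal.ofReal ε⁻¹)).trans (lintegral_lintegral_exp_catoniExponent_le_one hL hL01 hγ)
  rw [ENNReal.ofReal_inv_of_pos hε] at h ⊢
  have h0 : ENNReal.ofReal ε ≠ 0 := (ENNReal.ofReal_pos.2 hε).ne'
  rwa [mul_comm, ← div_eq_mul_inv,
    ENNReal.div_le_iff_le_mul (Or.inl h0) (Or.inl ENNReal.ofReal_ne_top), one_mul] at h

/-- Catoni's bound at a fixed inverse temperature, on a sample where the weight is controlled. -/
lemma integral_le_Phinv_of_lintegral_lt (hL : Measurable (Function.uncurry L))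
    (hL01 : ∀ θ z, L θ z ∈ Set.Icc (0 : ℝ) 1) (hm : 1 ≤ m) {l ε : ℝ} (hl : 0 < l) (hε : 0 < ε)
    {S : Fin m → 𝒵} (hS : ∫⁻ θ, ENNReal.ofReal (exp (catoniExponent L D (l / m) S θ)) ∂P <
      ENNReal.ofReal ε⁻¹)
    (Q : Measure Θ) [IsProbabilityMeasure Q] (hQ : klDiv Q P ≠ ⊤) :
    ∫ θ, (∫ z, L θ z ∂D) ∂Q ≤ Phinv (l / m)
      ((∫ θ, (1 / (m : ℝ)) * ∑ i, L θ (S i) ∂Q) + ((klDiv Q P).toReal - log ε) / l) := by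
  have hm0 : (0 : ℝ) < m := by exact_mod_cast hm
  have hγ : 0 < l / (m : ℝ) := by positivity
  set γ := l / (m : ℝ) with hγdef
  have hmγ : (m : ℝ) * γ = l := mul_div_cancel₀ _ hm0.ne'
  obtain ⟨hQP, hllr⟩ : Q ≪ P ∧ Integrable (llr Q P) Q := by
    by_contra h
    exact hQ (by rw [klDiv, if_neg h])
  have hkl : ∫ θ, llr Q P θ ∂Q ≤ (klDiv Q P).toReal := by
    rw [klDiv, if_pos ⟨hQP, hllr⟩, ENNReal.toReal_ofReal']
    exact le_max_left _ _
  have hexp : Integrable (fun θ => exp (catoniExponent L D γ S θ)) P :=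
    integrable_exp_catoniExponent hL hL01 hγ (g := fun θ => (S, θ)) (by fun_prop)
  have hlogP : log (∫ θ, exp (catoniExponent L D γ S θ) ∂P) ≤ -log ε := by
    rw [← ofReal_integral_eq_lintegral_ofReal hexp (ae_of_all _ fun θ => (exp_pos _).le),
      ENNReal.ofReal_lt_ofReal_iff (inv_pos.2 hε)] at hS
    rw [← log_inv]
    exact log_le_log (integral_exp_pos hexp) hS.le
  have hfQ : Integrable (catoniExponent L D γ S) Q :=
    Integrable.of_mem_Icc _ _
      ((measurable_catoniExponent hL γ).comp measurable_prodMk_left).aemeasurable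
      (ae_of_all Q (catoniExponent_mem_Icc hL hL01 hγ S))
  have hDV := integral_le_integral_llr_add_log hQP hllr hfQ hexp
  have hR : Measurable fun θ => ∫ z, L θ z ∂D :=
    hL.stronglyMeasurable.integral_prod_right.measurable
  have hR01 : ∀ θ, ∫ z, L θ z ∂D ∈ Set.Icc (0 : ℝ) 1 := fun θ =>
    integral_mem_Icc_of_forall_mem (hL.comp measurable_prodMk_left) (hL01 θ)
  have hRint : Integrable (fun θ => ∫ z, L θ z ∂D) Q :=
    Integrable.of_mem_Icc 0 1 hR.aemeasurable (ae_of_all Q hR01)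
  have hRbar := integral_mem_Icc_of_forall_mem (μ := Q) hR hR01
  set ρ := ∫ θ, (∫ z, L θ z ∂D) ∂Q with hρ
  have ha := one_sub_mul_pos (γ := γ) hRbar
  set a := 1 - (1 - exp (-γ)) * ρ with hadef
  have hLi : ∀ i, Integrable (fun θ => L θ (S i)) Q := fun i =>
    Integrable.of_mem_Icc 0 1 (hL.comp (measurable_id.prodMk measurable_const)).aemeasurable
      (ae_of_all Q fun θ => hL01 θ (S i))
  have hsum : Integrable (fun θ => ∑ i, L θ (S i)) Q := integrable_finsetSum _ fun i _ => hLi i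
  -- Concavity of the logarithm, through its tangent line at `a`.
  have hJensen : -γ * ∫ θ, ∑ i, L θ (S i) ∂Q - m * log a ≤ ∫ θ, catoniExponent L D γ S θ ∂Q := by
    have hpt : ∀ θ, -γ * (∑ i, L θ (S i)) -
        m * (log a - 1 + (1 - (1 - exp (-γ)) * ∫ z, L θ z ∂D) / a) ≤
        catoniExponent L D γ S θ := fun θ => by
      have hq := one_sub_mul_pos (γ := γ) (hR01 θ)
      have h := log_le_sub_one_of_pos (div_pos hq ha)
      rw [log_div hq.ne' ha.ne'] at h
      simp only [catoniExponent, Finset.sum_sub_distrib, ← Finset.mul_sum, Finset.sum_const,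
        Finset.card_univ, Fintype.card_fin, nsmul_eq_mul]
      have := mul_le_mul_of_nonneg_left h hm0.le
      linarith
    have i1 : Integrable (fun θ => -γ * ∑ i, L θ (S i)) Q := hsum.const_mul _
    have i3 : Integrable (fun θ => (1 - exp (-γ)) * ∫ z, L θ z ∂D) Q := hRint.const_mul _
    have i4 : Integrable (fun θ => (1 - (1 - exp (-γ)) * ∫ z, L θ z ∂D) / a) Q :=
      ((integrable_const 1).sub i3).div_const a
    have i2 : Integrable (fun θ => (m : ℝ) *
        (log a - 1 + (1 - (1 - exp (-γ)) * ∫ z, L θ z ∂D) / a)) Q :=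
      ((integrable_const _).add i4).const_mul _
    have h := integral_mono (i1.sub i2) hfQ hpt
    simp only [Pi.sub_apply] at h
    rw [integral_sub i1 i2, integral_const_mul, integral_const_mul,
      integral_add (integrable_const _) i4, integral_div, integral_sub (integrable_const 1) i3,
      integral_const_mul, ← hρ] at h
    simp only [integral_const, probReal_univ, one_smul] at h
    rw [← hadef, div_self ha.ne'] at h
    simpa using h
  rw [integral_const_mul]
  set s := ∫ θ, ∑ i, L θ (S i) ∂Q with hs
  set K := (klDiv Q P).toReal with hK
  have hmain : -γ * (1 / (m : ℝ) * s + (K - log ε) / l) ≤ log a := by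
    have h1 : (m : ℝ) * (-γ * (1 / (m : ℝ) * s + (K - log ε) / l)) = -γ * s - (K - log ε) := by
      rw [← mul_assoc, mul_neg, hmγ, hγdef]
      field_simp
      ring
    refine le_of_mul_le_mul_left ?_ hm0
    rw [h1]
    linarith
  rw [le_log_iff_exp_le ha] at hmain
  rw [Phinv, le_div_iff₀ (one_sub_exp_neg_pos hγ)]
  linarith

end Catoni

lemma tsum_ofReal_div_mul_succ_le {δ : ℝ} (hδ : 0 ≤ δ) :
    ∑' k : ℕ, ENNReal.ofReal (δ / ((k + 1) * (k + 2))) ≤ ENNReal.ofReal δ := by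
  refine ENNReal.tsum_le_of_sum_range_le fun n => ?_
  rw [← ENNReal.ofReal_sum_of_nonneg fun k _ => by positivity]
  refine ENNReal.ofReal_le_ofReal ?_
  have h : ∑ k ∈ Finset.range n, δ / (((k : ℝ) + 1) * (k + 2)) = δ - δ / (n + 1) := by
    induction n with
    | zero => simp
    | succ n ih =>
      rw [Finset.sum_range_succ, ih]
      push_cast
      field_simp
      ring
  rw [h]
  exact sub_le_self _ (by positivity)

lemma neg_log_div_mul_succ_le {α δ l : ℝ} {k : ℕ} (hα : 1 < α) (hδ : 0 < δ) (hkl : α ^ k ≤ l) :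
    -log (δ / ((k + 1) * (k + 2))) ≤ -log δ + 2 * log (log (α ^ 2 * l) / log α) := by
  have hlα : 0 < log α := log_pos hα
  have hα0 : 0 < α := one_pos.trans hα
  have hk : (k : ℝ) + 2 ≤ log (α ^ 2 * l) / log α := by
    rw [le_div_iff₀ hlα]
    have h : log (α ^ (k + 2)) ≤ log (α ^ 2 * l) :=
      log_le_log (by positivity) (by rw [pow_add, mul_comm]; gcongr)
    rw [log_pow] at h
    push_cast at h
    exact h
  have h1 : log ((k : ℝ) + 2) ≤ log (log (α ^ 2 * l) / log α) := log_le_log (by positivity) hk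
  have h2 : log ((k : ℝ) + 1) ≤ log ((k : ℝ) + 2) := log_le_log (by positivity) (by linarith)
  rw [log_div hδ.ne' (by positivity), log_mul (by positivity) (by positivity)]
  linarith

/-- Comparison of the bound at a grid point `l₀` with the bound at `l ∈ [l₀, α l₀]`. -/
lemma le_Phinv_of_le_Phinv_grid {ρ r B B' l₀ l α M : ℝ} (hM : 0 < M) (hρ : ρ ≤ 1) (hr : 0 ≤ r)
    (hB : 0 ≤ B) (hBB' : B ≤ B') (hl₀ : 0 < l₀) (hl : l₀ ≤ l) (hlα : l ≤ α * l₀)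
    (h : ρ ≤ Phinv (l₀ / M) (r + B / l₀)) :
    ρ ≤ Phinv (l / M) (r + α / l * B') := by
  have hl' : 0 < l := hl₀.trans_le hl
  have hα : 0 < α := pos_of_mul_pos_left (hl'.trans_le hlα) hl₀.le
  rcases le_total 1 (r + α / l * B') with h1 | h1
  · exact hρ.trans (one_le_Phinv (by positivity) h1)
  have hstep : r + B / l₀ ≤ r + α / l * B' := by
    have : 1 / l₀ ≤ α / l := by rw [div_le_div_iff₀ hl₀ hl']; linarith
    have := mul_le_mul this hBB' hB (by positivity)
    rw [one_div_mul_eq_div] at this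
    linarith
  calc ρ ≤ Phinv (l₀ / M) (r + B / l₀) := h
    _ ≤ Phinv (l₀ / M) (r + α / l * B') := Phinv_monotone_right (by positivity) hstep
    _ ≤ Phinv (l / M) (r + α / l * B') :=
      Phinv_mono_left (by positivity) (by gcongr)
        ⟨by have : 0 ≤ B' := hB.trans hBB'
            positivity, h1⟩

/-- Theorem 1 (Catoni's PAC-Bayes bound).  When `KL(Q‖P) = ∞` the claimed bound is
trivially true (its right-hand side is `+∞`), which is expressed by the disjunction. -/
theorem statement17 {Θ 𝒵 : Type*} [MeasurableSpace Θ] [MeasurableSpace 𝒵]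
    (L : Θ → 𝒵 → ℝ) (hL : Measurable (Function.uncurry L))
    (hL01 : ∀ θ z, L θ z ∈ Set.Icc (0 : ℝ) 1)
    (D : Measure 𝒵) [IsProbabilityMeasure D] (m : ℕ) (hm : 1 ≤ m)
    (P : Measure Θ) [IsProbabilityMeasure P]
    (α δ : ℝ) (hα : 1 < α) (hδ : δ ∈ Set.Ioc (0 : ℝ) 1) :
    1 - ENNReal.ofReal δ ≤
      Measure.pi (fun _ : Fin m => D)
        {S | ∀ Q : Measure Θ, IsProbabilityMeasure Q →
          klDiv Q P = ⊤ ∨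
          ∫ θ, (∫ z, L θ z ∂D) ∂Q ≤
            ⨅ l : Set.Ioi (1 : ℝ),
              Phinv ((l : ℝ) / m)
                ((∫ θ, (1 / (m : ℝ)) * ∑ i, L θ (S i) ∂Q) +
                  (α / (l : ℝ)) * ((klDiv Q P).toReal - Real.log δ +
                    2 * Real.log (Real.log (α ^ 2 * (l : ℝ)) / Real.log α)))} := by
  have hm0 : (0 : ℝ) < m := by exact_mod_cast hm
  have hα0 : 0 < α := one_pos.trans hα
  have hδ0 : 0 < δ := hδ.1
  set ε : ℕ → ℝ := fun k => δ / ((k + 1) * (k + 2)) with hε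
  have hε0 : ∀ k, 0 < ε k := fun k => by simp only [hε]; positivity
  set bad : ℕ → Set (Fin m → 𝒵) := fun k => {S | ENNReal.ofReal (ε k)⁻¹ ≤
    ∫⁻ θ, ENNReal.ofReal (exp (catoniExponent L D (α ^ k / m) S θ)) ∂P} with hbad
  have hbadmeas : MeasurableSet (⋃ k, bad k) := MeasurableSet.iUnion fun k =>
    measurableSet_le measurable_const (measurable_lintegral_exp_catoniExponent hL _)
  have hbadle : Measure.pi (fun _ : Fin m => D) (⋃ k, bad k) ≤ ENNReal.ofReal δ :=
    (measure_iUnion_le _).trans <| (ENNReal.tsum_le_tsum fun k =>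
      measure_le_lintegral_exp_catoniExponent hL hL01 (by positivity) (hε0 k)).trans
        (tsum_ofReal_div_mul_succ_le hδ0.le)
  refine (tsub_le_tsub_left hbadle 1).trans ?_
  rw [← prob_compl_eq_one_sub hbadmeas]
  refine measure_mono fun S hS Q hQ => or_iff_not_imp_left.2 fun hkl => ?_
  have : Nonempty (Set.Ioi (1 : ℝ)) := ⟨⟨2, by norm_num⟩⟩
  refine le_ciInf fun l => ?_
  obtain ⟨k, hk1, hk2⟩ := exists_nat_pow_near (le_of_lt l.2) hα
  have hSk : S ∉ bad k := fun h => hS (Set.mem_iUnion.2 ⟨k, h⟩)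
  have hfix := integral_le_Phinv_of_lintegral_lt hL hL01 hm (pow_pos hα0 k) (hε0 k)
    (not_le.1 hSk) Q hkl
  have hR01 := integral_mem_Icc_of_forall_mem (μ := Q)
    hL.stronglyMeasurable.integral_prod_right.measurable fun θ =>
      integral_mem_Icc_of_forall_mem (μ := D) (hL.comp measurable_prodMk_left) (hL01 θ)
  have hεle : ε k ≤ 1 :=
    (div_le_self hδ0.le (by nlinarith [(k.cast_nonneg : (0 : ℝ) ≤ k)])).trans hδ.2
  have hlogε : log (ε k) ≤ 0 := log_nonpos (hε0 k).le hεle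
  refine le_Phinv_of_le_Phinv_grid hm0 hR01.2
    (integral_nonneg fun θ => mul_nonneg (by positivity)
      (Finset.sum_nonneg fun i _ => (hL01 θ (S i)).1))
    (sub_nonneg.2 (hlogε.trans ENNReal.toReal_nonneg)) ?_ (pow_pos hα0 k) hk1
    (by rw [← pow_succ']; exact hk2.le) hfix
  have := neg_log_div_mul_succ_le hα hδ0 hk1
  linarith
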